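/- Let P be a finite nonempty poset with |P| elements. Then for every integer n with n ≥ |P|²/2 + 4, the induced saturation number satisfies sat*(n, P) ≤ 2·n^(⌊|P|²/4⌋+1). In particular, sat*(n, P) = O(n^c) for a constant c ≤ |P|²/4 + 1 depending only on P. -/

import Mathlib

/-- A family `F` of subsets of `[n]` contains an induced copy of the poset `P`
if there is an injective map `f` from `P` into `F` such that
`p ≤ q` in `P` iff `f p ⊆ f q`. -/
def HasCopy (P : Type*) [PartialOrder P] {n : ℕ} (F : Finset (Finset (Fin n))) : Prop :=
  ∃ f : P → Finset (Fin n), Function.Injective f ∧ (∀ p, f p ∈ F) ∧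
    ∀ p q, p ≤ q ↔ f p ⊆ f q

/-- `F` is `P`-saturated: it contains no induced copy of `P`, but adding any
other subset of `[n]` creates an induced copy of `P`. -/
def IsSat (P : Type*) [PartialOrder P] {n : ℕ} (F : Finset (Finset (Fin n))) : Prop :=
  ¬ HasCopy P F ∧ ∀ S : Finset (Fin n), S ∉ F → HasCopy P (insert S F)

/-- The induced saturation number `sat*(n, P)`: the minimum size of a
`P`-saturated family of subsets of `[n]`. -/
noncomputable def satNum (n : ℕ) (P : Type*) [PartialOrder P] : ℕ :=
  sInf {m | ∃ F : Finset (Finset (Fin n)), IsSat P F ∧ F.card = m}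

open Relation in
/-- If every vertex reaches `A` along `R`, then one outgoing `R`-edge per vertex outside `A`
already suffices to reach `A`. -/
lemma exists_next_reaching {V : Type*} {R : V → V → Prop} {A : Set V}
    (h : ∀ v, ∃ a ∈ A, ReflTransGen R v a) :
    ∃ next : V → V, (∀ v, v ∉ A → R v (next v)) ∧
      ∀ v, ∃ a ∈ A, ReflTransGen (fun x y => x ∉ A ∧ y = next x) v a := by
  classical
  let S : ℕ → V → Prop := fun k =>
    Nat.rec (motive := fun _ => V → Prop) (fun v => v ∈ A) (fun _ T v => ∃ w, R v w ∧ T w) k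
  have hS : ∀ v, ∃ k, S k v := by
    intro v
    obtain ⟨a, ha, hva⟩ := h v
    induction hva using ReflTransGen.head_induction_on with
    | refl => exact ⟨0, ha⟩
    | head hxy _ ih =>
      obtain ⟨k, hk⟩ := ih
      exact ⟨k + 1, _, hxy, hk⟩
  let d : V → ℕ := fun v => Nat.find (hS v)
  have hstep : ∀ v, ∃ w, v ∉ A → R v w ∧ d w < d v := by
    intro v
    by_cases hv : v ∈ A
    · exact ⟨v, fun h => absurd hv h⟩
    · have hd : S (d v) v := Nat.find_spec (hS v)
      rcases hk : d v with _ | k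
      · rw [hk] at hd
        exact absurd hd hv
      · rw [hk] at hd
        obtain ⟨w, hw, hkw⟩ := hd
        exact ⟨w, fun _ => ⟨hw, Nat.lt_succ_of_le (Nat.find_min' (hS w) hkw)⟩⟩
  choose next hnext using hstep
  refine ⟨next, fun v hv => (hnext v hv).1, fun v => ?_⟩
  induction hk : d v using Nat.strong_induction_on generalizing v with
  | _ k ih =>
    by_cases hv : v ∈ A
    · exact ⟨v, hv, .refl⟩
    · obtain ⟨a, ha, hwa⟩ := ih _ (hk ▸ (hnext v hv).2) (next v) rfl
      exact ⟨a, ha, .head ⟨hv, rfl⟩ hwa⟩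

open Relation in
lemma Relation.ReflTransGen.restrict_of_cycle {V : Type*} {R : V → V → Prop} {x y : V}
    (h : ReflTransGen R x y) (h' : ReflTransGen R y x) :
    ReflTransGen (fun a b => R a b ∧ ReflTransGen R b a) x y := by
  induction h using ReflTransGen.head_induction_on with
  | refl => exact .refl
  | head hac hcy ih => exact .head ⟨hac, hcy.trans h'⟩ (ih (h'.tail hac))

/-- Mutual reachability. -/
def reachSetoid {V : Type*} (R : V → V → Prop) : Setoid V where
  r x y := Relation.ReflTransGen R x y ∧ Relation.ReflTransGen R y x
  iseqv := ⟨fun _ => ⟨.refl, .refl⟩, fun h => ⟨h.2, h.1⟩,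
    fun h h' => ⟨h.1.trans h'.1, h'.2.trans h.2⟩⟩

open Relation in
/-- The number of edges inside the strong components of a digraph none of whose edges is implied
by a path through the other ones. -/
lemma card_edges_within_components_le {V : Type*} [Fintype V] (E : Finset (V × V))
    (H : ∀ e ∈ E, ¬ ReflTransGen (fun x y => (x, y) ∈ E ∧ (x, y) ≠ e) e.1 e.2)
    (I : Finset (V × V))
    (hI : ∀ e ∈ I, e ∈ E ∧ (reachSetoid fun x y => (x, y) ∈ E) e.1 e.2) :
    I.card + 2 * Nat.card (Quotient (reachSetoid fun x y => (x, y) ∈ E)) ≤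
      2 * Fintype.card V := by
  classical
  let R : V → V → Prop := fun x y => (x, y) ∈ E
  let s := reachSetoid R
  let rep : V → V := fun v => (Quotient.mk s v).out
  have hrep : ∀ v, s (rep v) v := fun v => Quotient.exact (Quotient.out_eq _)
  have rep_congr : ∀ {u v}, s u v → rep u = rep v := fun h => by
    simp only [rep]; rw [Quotient.sound h]
  let A : Set V := {v | rep v = v}
  have hA : ∀ v, rep v ∈ A := fun v => rep_congr (hrep v)
  let Rin : V → V → Prop := fun a b => R a b ∧ ReflTransGen R b a
  have hRin : ∀ {a b}, Rin a b → s a b := fun h => ⟨.single h.1, h.2⟩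
  obtain ⟨nx, hnx, hnx'⟩ := exists_next_reaching (R := Rin) (A := A) fun v =>
    ⟨rep v, hA v, (hrep v).2.restrict_of_cycle (hrep v).1⟩
  obtain ⟨pr, hpr, hpr'⟩ := exists_next_reaching (R := Function.swap Rin) (A := A) fun v =>
    ⟨rep v, hA v, ((hrep v).1.restrict_of_cycle (hrep v).2).swap⟩
  let N : Finset V := Finset.univ.filter fun v => v ∉ A
  let T : Finset (V × V) := N.image (fun v => (v, nx v)) ∪ N.image (fun v => (pr v, v))
  have hTcard : T.card ≤ 2 * N.card := by
    refine (Finset.card_union_le _ _).trans ?_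
    have h1 := Finset.card_image_le (s := N) (f := fun v => (v, nx v))
    have h2 := Finset.card_image_le (s := N) (f := fun v => (pr v, v))
    omega
  have hToRep : ∀ v, ReflTransGen (fun x y => R x y ∧ (x, y) ∈ T) v (rep v) := by
    intro v
    obtain ⟨a, ha, hva⟩ := hnx' v
    have hs : s v a := by
      clear ha
      induction hva with
      | refl => exact s.refl _
      | tail _ h ih =>
        obtain ⟨h1, rfl⟩ := h
        exact s.trans ih (hRin (hnx _ h1))
    have hav : a = rep v := by rw [rep_congr hs]; exact ha.symm
    rw [← hav]
    refine ReflTransGen.mono ?_ _ _ hva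
    rintro x y ⟨hx, rfl⟩
    exact ⟨(hnx x hx).1, Finset.mem_union_left _
      (Finset.mem_image.2 ⟨x, by simpa [N] using hx, rfl⟩)⟩
  have hFromRep : ∀ v, ReflTransGen (fun x y => R x y ∧ (x, y) ∈ T) (rep v) v := by
    intro v
    obtain ⟨a, ha, hva⟩ := hpr' v
    have hs : s v a := by
      clear ha
      induction hva with
      | refl => exact s.refl _
      | tail _ h ih =>
        obtain ⟨h1, rfl⟩ := h
        exact s.trans ih (s.symm (hRin (hpr _ h1)))
    have hav : a = rep v := by rw [rep_congr hs]; exact ha.symm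
    rw [← hav]
    refine ReflTransGen.mono ?_ _ _ hva.swap
    rintro x y ⟨hx, rfl⟩
    exact ⟨(hpr y hx).1, Finset.mem_union_right _
      (Finset.mem_image.2 ⟨y, by simpa [N] using hx, rfl⟩)⟩
  have hIT : I ⊆ T := by
    intro e he
    by_contra heT
    obtain ⟨heE, hes⟩ := hI e he
    refine H e heE ?_
    have h1 := hToRep e.1
    rw [rep_congr hes] at h1
    refine ReflTransGen.mono ?_ _ _ (h1.trans (hFromRep e.2))
    rintro x y ⟨hxy, hT⟩
    exact ⟨hxy, fun h => heT (h ▸ hT)⟩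
  have hN : N.card + Nat.card (Quotient s) = Fintype.card V := by
    have h1 : Nat.card (Quotient s) = (Finset.univ.filter fun v => v ∈ A).card := by
      rw [Nat.card_eq_fintype_card, ← Finset.card_univ]
      refine Finset.card_bij (fun q _ => q.out) ?_ ?_ ?_
      · intro q _
        simp [A, rep]
      · intro a _ b _ h
        exact Quotient.out_injective h
      · intro v hv
        exact ⟨Quotient.mk s v, Finset.mem_univ _, by simpa [A] using hv⟩
    rw [h1, add_comm, ← Finset.card_univ]
    exact Finset.card_filter_add_card_filter_not _
  have := Finset.card_le_card hIT
  change I.card + 2 * Nat.card (Quotient s) ≤ _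
  omega

open Relation in
/-- The number of edges between distinct strong components of a digraph none of whose edges is
implied by a path through the other ones. -/
lemma card_edges_between_components_le {V : Type*} [Finite V] (E : Finset (V × V))
    (H : ∀ e ∈ E, ¬ ReflTransGen (fun x y => (x, y) ∈ E ∧ (x, y) ≠ e) e.1 e.2)
    (C : Finset (V × V))
    (hC : ∀ e ∈ C, e ∈ E ∧ ¬ (reachSetoid fun x y => (x, y) ∈ E) e.1 e.2) :
    C.card ≤ Nat.card (Quotient (reachSetoid fun x y => (x, y) ∈ E)) ^ 2 / 4 := by
  classical
  let R : V → V → Prop := fun x y => (x, y) ∈ E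
  let s := reachSetoid R
  let π : V → Quotient s := Quotient.mk s
  have := Fintype.ofFinite (Quotient s)
  have hπ : ∀ {x y}, π x = π y ↔ s x y := Quotient.eq
  -- a path inside a component avoids every edge between components
  have avoid : ∀ {x y : V} {e : V × V}, π x = π y → π e.1 ≠ π e.2 →
      ReflTransGen (fun a b => R a b ∧ (a, b) ≠ e) x y := by
    intro x y e hxy he
    refine ReflTransGen.mono ?_ _ _ ((hπ.1 hxy).1.restrict_of_cycle (hπ.1 hxy).2)
    rintro a b ⟨hab, hba⟩
    refine ⟨hab, ?_⟩
    rintro rfl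
    exact he (hπ.2 ⟨.single hab, hba⟩)
  let D : Quotient s → Quotient s → Prop := fun p q =>
    p ≠ q ∧ ∃ x y, R x y ∧ π x = p ∧ π y = q
  have no_trans : ∀ {p q r}, D p q → D q r → ¬ D p r := by
    rintro _ _ _ ⟨hpq, x, y, hxy, rfl, rfl⟩ ⟨hqr, y', z, hyz, hy, rfl⟩ ⟨hpr, x', z', hxz, hx, hz⟩
    have he : π (x', z').1 ≠ π (x', z').2 := by
      simpa only [hx, hz] using hpr
    refine H (x', z') hxz ((avoid hx he).trans (.head ⟨hxy, ?_⟩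
      ((avoid hy.symm he).trans (.head ⟨hyz, ?_⟩ (avoid hz.symm he)))))
    · intro h
      rw [Prod.mk.injEq] at h
      exact hqr (by rw [h.2, hz])
    · intro h
      rw [Prod.mk.injEq] at h
      exact hpq (by rw [← hx, ← h.1, hy])
  have reach_of_D : ∀ {x y}, D (π x) (π y) → ReflTransGen R x y := by
    rintro x y ⟨_, x', y', h, hx, hy⟩
    exact (hπ.1 hx).2.trans (.head h (hπ.1 hy).1)
  have no_cycle : ∀ {p q r}, D p q → D q r → ¬ D r p := by
    intro p q r
    induction p using Quotient.inductionOn with | _ x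
    induction q using Quotient.inductionOn with | _ y
    induction r using Quotient.inductionOn with | _ z
    intro h1 h2 h3
    exact h1.1 (hπ.2 ⟨reach_of_D h1, (reach_of_D h2).trans (reach_of_D h3)⟩)
  let G : SimpleGraph (Quotient s) :=
    { Adj := fun p q => D p q ∨ D q p
      symm := ⟨fun _ _ h => h.symm⟩
      loopless := ⟨fun _ h => h.elim (fun h => h.1 rfl) (fun h => h.1 rfl)⟩ }
  have hG : G.CliqueFree (2 + 1) := by
    intro t ht
    obtain ⟨a, b, c, hab, hac, hbc, -⟩ := SimpleGraph.is3Clique_iff.1 ht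
    rcases hab with hab | hab <;> rcases hac with hac | hac <;> rcases hbc with hbc | hbc
    · exact no_trans hab hbc hac
    · exact no_trans hac hbc hab
    · exact no_cycle hab hbc hac
    · exact no_trans hac hab hbc
    · exact no_trans hab hac hbc
    · exact no_cycle hac hbc hab
    · exact no_trans hbc hac hab
    · exact no_trans hbc hab hac
  have hCG : C.card ≤ G.edgeFinset.card := by
    refine Finset.card_le_card_of_injOn (fun e => s(π e.1, π e.2)) ?_ ?_
    · intro e he
      obtain ⟨heE, hes⟩ := hC e he
      simp only [Finset.mem_coe, SimpleGraph.mem_edgeFinset, SimpleGraph.mem_edgeSet]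
      exact Or.inl ⟨fun h => hes (hπ.1 h), e.1, e.2, heE, rfl, rfl⟩
    · rintro ⟨x, y⟩ he ⟨x', y'⟩ he' h
      obtain ⟨heE, hes⟩ := hC _ he
      obtain ⟨heE', -⟩ := hC _ he'
      have hne : π x ≠ π y := fun h => hes (hπ.1 h)
      rcases Sym2.eq_iff.1 h with ⟨h1, h2⟩ | ⟨h1, h2⟩
      · by_contra hcon
        exact H (x, y) heE ((avoid h1 hne).trans
          (.head ⟨heE', fun h => hcon h.symm⟩ (avoid h2.symm hne)))
      · exact absurd (hπ.2 ⟨.single heE, (hπ.1 h2).1.trans (.head heE' (hπ.1 h1).2)⟩) hne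
  have hT := hG.card_edgeFinset_le
  rw [← Nat.card_eq_fintype_card] at hT
  refine hCG.trans (hT.trans ?_)
  change _ ≤ Nat.card (Quotient s) ^ 2 / 4
  rcases Nat.mod_two_eq_zero_or_one (Nat.card (Quotient s)) with h | h <;> rw [h]
  · simp
  · simp only [one_pow, Nat.choose_succ_self, add_zero]
    exact Nat.div_le_div_right (by omega)

open Relation in
/-- A digraph on `m` vertices none of whose edges is implied by a path through the other ones has
at most `m² / 4 + 2` edges. -/
lemma card_edges_le_of_irredundant {V : Type*} [Fintype V] [Nonempty V] (E : Finset (V × V))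
    (H : ∀ e ∈ E, ¬ ReflTransGen (fun x y => (x, y) ∈ E ∧ (x, y) ≠ e) e.1 e.2) :
    E.card ≤ Fintype.card V ^ 2 / 4 + 2 := by
  classical
  let s := reachSetoid fun x y => (x, y) ∈ E
  have h1 := card_edges_within_components_le E H (E.filter fun e => s e.1 e.2)
    fun e he => Finset.mem_filter.1 he
  have h2 := card_edges_between_components_le E H (E.filter fun e => ¬ s e.1 e.2)
    fun e he => Finset.mem_filter.1 he
  have h3 := Finset.card_filter_add_card_filter_not (s := E) fun e => s e.1 e.2
  have h4 : 0 < Nat.card (Quotient s) :=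
    haveI : Nonempty (Quotient s) := ⟨Quotient.mk s (Classical.arbitrary V)⟩
    Nat.card_pos
  change _ + 2 * Nat.card (Quotient s) ≤ _ at h1
  change _ ≤ Nat.card (Quotient s) ^ 2 / 4 at h2
  generalize Nat.card (Quotient s) = m at *
  generalize Fintype.card V = k at *
  obtain ⟨t, rfl⟩ : ∃ t, k = m + t := ⟨k - m, by omega⟩
  have key : 2 * t + m ^ 2 / 4 ≤ (m + t) ^ 2 / 4 + 2 := by
    rcases Nat.lt_or_ge m 2 with hm | hm
    · obtain rfl : m = 1 := by omega
      have : 8 * t ≤ (1 + t) ^ 2 + 8 := by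
        rcases Nat.lt_or_ge t 6 with ht | ht
        · interval_cases t <;> norm_num
        · nlinarith
      omega
    · have : 8 * t + m ^ 2 ≤ (m + t) ^ 2 + 8 := by
        zify at *
        nlinarith [sq_nonneg ((t : ℤ) - 2),
          mul_nonneg (by positivity : (0 : ℤ) ≤ t) (sub_nonneg.2 hm)]
      omega
  omega

/-- A representation of a poset by finite sets can be replaced by one on a ground set of size at
most `|P|² / 4 + 2`, without increasing the size of any set. -/
lemma exists_small_representation {P α : Type*} [PartialOrder P] [Fintype P] [Nonempty P]
    (f : P → Finset α) (hf : ∀ p q, p ≤ q ↔ f p ⊆ f q) :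
    ∃ k ≤ Fintype.card P ^ 2 / 4 + 2, ∃ g : P → Finset (Fin k),
      (∀ p q, p ≤ q ↔ g p ⊆ g q) ∧ ∀ p, (g p).card ≤ (f p).card := by
  classical
  let good : Finset α → Prop := fun W => ∀ p q, (∀ x ∈ W, x ∈ f p → x ∈ f q) → p ≤ q
  have hgood : good (Finset.univ.biUnion f) := fun p q h => (hf p q).2 fun x hx =>
    h x (Finset.mem_biUnion.2 ⟨p, Finset.mem_univ _, hx⟩) hx
  obtain ⟨W, hW, hmin⟩ := wellFounded_lt.has_min {W | good W} ⟨_, hgood⟩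
  have hwit : ∀ w : W, ∃ e : P × P, (∀ x ∈ W, x ≠ w → x ∈ f e.1 → x ∈ f e.2) ∧
      (w : α) ∈ f e.1 ∧ (w : α) ∉ f e.2 := by
    intro w
    have hnot : ¬ good (W.erase w) := fun h => hmin _ h (Finset.erase_ssubset w.2)
    simp only [good, not_forall] at hnot
    obtain ⟨p, q, hx, hpq⟩ := hnot
    have hx' : ∀ x ∈ W, x ≠ w → x ∈ f p → x ∈ f q := fun x hxW hxw =>
      hx x (Finset.mem_erase.2 ⟨hxw, hxW⟩)
    refine ⟨(p, q), hx', ?_⟩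
    by_contra hcon
    refine hpq (hW p q fun x hxW hxp => ?_)
    by_cases hxw : x = w
    · subst hxw
      by_contra hxq
      exact hcon ⟨hxp, hxq⟩
    · exact hx' x hxW hxw hxp
  choose e he hep heq using hwit
  have hinj : Function.Injective e := by
    intro w w' h
    by_contra hne
    refine heq w' (he w w' w'.2 (fun h => hne (Subtype.ext h.symm)) ?_ |> fun h' => h ▸ h')
    rw [h]
    exact hep w'
  have hcard : W.card ≤ Fintype.card P ^ 2 / 4 + 2 := by
    have := card_edges_le_of_irredundant (Finset.univ.image e) ?_
    · rwa [Finset.card_image_of_injective _ hinj, Finset.card_univ, Fintype.card_coe] at this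
    · intro d hd hpath
      obtain ⟨w, -, rfl⟩ := Finset.mem_image.1 hd
      refine heq w ?_
      generalize (e w).2 = q at hpath
      induction hpath with
      | refl => exact hep w
      | tail _ hstep ih =>
        obtain ⟨hmem, hne⟩ := hstep
        obtain ⟨w', -, hw'⟩ := Finset.mem_image.1 hmem
        have h := he w' w w.2 (fun h => hne (by rw [← hw', Subtype.ext h]))
        rw [hw'] at h
        exact h ih
  refine ⟨W.card, hcard, fun p => ((f p).subtype (· ∈ W)).map W.equivFin.toEmbedding, ?_, ?_⟩
  · intro p q
    rw [Finset.map_subset_map]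
    constructor
    · intro h x hx
      rw [Finset.mem_subtype] at hx ⊢
      exact (hf p q).1 h hx
    · intro h
      refine hW p q fun x hxW hxp => ?_
      have := @h ⟨x, hxW⟩ (Finset.mem_subtype.2 hxp)
      exact Finset.mem_subtype.1 this
  · intro p
    rw [Finset.card_map, Finset.card_subtype]
    exact Finset.card_filter_le _ _

lemma injective_of_le_iff_subset {P α : Type*} [PartialOrder P] {f : P → Finset α}
    (hf : ∀ p q, p ≤ q ↔ f p ⊆ f q) : Function.Injective f := fun p q h =>
  le_antisymm ((hf p q).2 h.subset) ((hf q p).2 h.symm.subset)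

/-- A family without a copy of `P` that contains all sets of size less than `h` shatters no set as
large as the ground set of a representation of `P` by sets of size at most `h`. -/
lemma card_lt_of_shatters {P : Type*} [PartialOrder P] {n k h : ℕ} {g : P → Finset (Fin k)}
    (hg : ∀ p q, p ≤ q ↔ g p ⊆ g q) (hgh : ∀ p, (g p).card ≤ h)
    {F : Finset (Finset (Fin n))} (hF : ∀ S : Finset (Fin n), S.card < h → S ∈ F)
    (hfree : ¬ HasCopy P F) {S : Finset (Fin n)} (hS : F.Shatters S) : S.card < k := by
  by_contra! hk
  let ι : Fin k ↪ Fin n := (S.orderEmbOfCardLe hk).toEmbedding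
  have hι : ∀ p, (g p).map ι ⊆ S := by
    intro p x hx
    obtain ⟨i, -, rfl⟩ := Finset.mem_map.1 hx
    exact S.orderEmbOfCardLe_mem hk i
  have hex : ∀ p, ∃ A ∈ F, S ∩ A = (g p).map ι ∧ ((g p).card < h → A = (g p).map ι) := by
    intro p
    by_cases hp : (g p).card < h
    · exact ⟨_, hF _ (by rwa [Finset.card_map]), Finset.inter_eq_right.2 (hι p), fun _ => rfl⟩
    · obtain ⟨A, hA, hAS⟩ := hS (hι p)
      exact ⟨A, hA, hAS, fun h => absurd h hp⟩
  choose A hAF hAS hA using hex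
  have hle : ∀ p q, p ≤ q ↔ A p ⊆ A q := by
    intro p q
    constructor
    · intro hpq
      rcases hpq.eq_or_lt with rfl | hlt
      · exact subset_rfl
      · have hss : g p ⊂ g q :=
          ⟨(hg p q).1 hpq, fun h => hlt.not_ge ((hg q p).2 h)⟩
        rw [hA p ((Finset.card_lt_card hss).trans_le (hgh q))]
        refine (Finset.map_subset_map.2 hss.1).trans ?_
        rw [← hAS q]
        exact Finset.inter_subset_right
    · intro h
      rw [hg, ← Finset.map_subset_map (f := ι), ← hAS p, ← hAS q]
      exact Finset.inter_subset_inter_left h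
  exact hfree ⟨A, injective_of_le_iff_subset hle, hAF, hle⟩

lemma exists_isSat_superset {P : Type*} [PartialOrder P] {n : ℕ} {F : Finset (Finset (Fin n))}
    (hF : ¬ HasCopy P F) : ∃ F', F ⊆ F' ∧ IsSat P F' := by
  obtain ⟨F', hFF', hmax⟩ :=
    Finite.exists_le_maximal (p := fun F : Finset (Finset (Fin n)) => ¬ HasCopy P F) hF
  refine ⟨F', hFF', hmax.1, fun S hS => ?_⟩
  by_contra hcon
  exact hS (hmax.2 hcon (Finset.subset_insert S F') (Finset.mem_insert_self S F'))

lemma sum_range_succ_choose_le {n : ℕ} (hn : 2 ≤ n) (d : ℕ) :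
    ∑ i ∈ Finset.range (d + 1), n.choose i ≤ 2 * n ^ d := by
  induction d with
  | zero => simp
  | succ d ih =>
    rw [Finset.sum_range_succ]
    have h1 := Nat.choose_le_pow n (d + 1)
    have h2 : 2 * n ^ d ≤ n * n ^ d := Nat.mul_le_mul_right _ hn
    rw [pow_succ'] at *
    omega

/-- A finite poset has a copy among the finite sets of naturals, and one whose largest set is as
small as possible. -/
lemma exists_minimal_height (P : Type*) [PartialOrder P] [Fintype P] [Nonempty P] :
    ∃ (h : ℕ) (f : P → Finset ℕ), (∀ p q, p ≤ q ↔ f p ⊆ f q) ∧ (∀ p, (f p).card ≤ h) ∧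
      ∀ f' : P → Finset ℕ, (∀ p q, p ≤ q ↔ f' p ⊆ f' q) → ∃ p, h ≤ (f' p).card := by
  let good : ℕ → Prop := fun h => ∃ f : P → Finset ℕ, (∀ p q, p ≤ q ↔ f p ⊆ f q) ∧
    ∀ p, (f p).card ≤ h
  have hgood : ∃ h, good h := by
    classical
    let ι : P ↪ ℕ := (Fintype.equivFin P).toEmbedding.trans Fin.valEmbedding
    refine ⟨Fintype.card P, fun p => (Finset.univ.filter (· ≤ p)).map ι, fun p q => ?_, fun p => ?_⟩
    · rw [Finset.map_subset_map]
      constructor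
      · intro h x hx
        simp only [Finset.mem_filter, Finset.mem_univ, true_and] at hx ⊢
        exact hx.trans h
      · intro h
        simpa using @h p (by simp)
    · rw [Finset.card_map]
      exact Finset.card_le_univ _
  classical
  obtain ⟨f, hf, hfh⟩ := Nat.find_spec hgood
  refine ⟨Nat.find hgood, f, hf, hfh, fun f' hf' => ?_⟩
  by_contra! hlt
  obtain ⟨p⟩ := ‹Nonempty P›
  have hpos := hlt p
  refine Nat.find_min hgood (m := Nat.find hgood - 1) (by omega) ⟨f', hf', fun q => ?_⟩
  have := hlt q
  omega

/-- For every finite nonempty poset `P` and every `n ≥ |P|²/2 + 4`,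
`sat*(n, P) ≤ 2 · n ^ (⌊|P|²/4⌋ + 1)`; in particular `sat*(n, P) = O(n^c)`
with `c ≤ |P|²/4 + 1`. -/
theorem sat_le_poly (P : Type*) [PartialOrder P] [Fintype P] [Nonempty P] (n : ℕ)
    (hn : ((Fintype.card P : ℝ)) ^ 2 / 2 + 4 ≤ (n : ℝ)) :
    satNum n P ≤ 2 * n ^ ((Fintype.card P) ^ 2 / 4 + 1) := by
  classical
  obtain ⟨h, f, hf, hfh, hmin⟩ := exists_minimal_height P
  obtain ⟨k, hk, g, hg, hgf⟩ := exists_small_representation f hf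
  have hfree : ¬ HasCopy P (Finset.univ.filter fun S : Finset (Fin n) => S.card < h) := by
    rintro ⟨c, -, hcF, hc⟩
    obtain ⟨p, hp⟩ := hmin (fun p => (c p).map Fin.valEmbedding) fun p q => by
      rw [Finset.map_subset_map, hc]
    rw [Finset.card_map] at hp
    exact hp.not_gt (Finset.mem_filter.1 (hcF p)).2
  obtain ⟨F, hF, hsat⟩ := exists_isSat_superset hfree
  have hdim : F.vcDim ≤ Fintype.card P ^ 2 / 4 + 1 := by
    refine Finset.sup_le fun S hS => ?_
    have := card_lt_of_shatters hg (fun p => (hgf p).trans (hfh p))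
      (fun S hS => hF (Finset.mem_filter.2 ⟨Finset.mem_univ _, hS⟩)) hsat.1
      (Finset.mem_shatterer.1 hS)
    omega
  have hn2 : 2 ≤ n := by
    have : (2 : ℝ) ≤ n := by nlinarith [sq_nonneg (Fintype.card P : ℝ)]
    exact_mod_cast this
  calc satNum n P ≤ F.card := Nat.sInf_le ⟨F, hsat, rfl⟩
    _ ≤ F.shatterer.card := F.card_le_card_shatterer
    _ ≤ ∑ i ∈ Finset.Iic F.vcDim, n.choose i := by
      simpa using Finset.card_shatterer_le_sum_vcDim (𝒜 := F)
    _ ≤ ∑ i ∈ Finset.range (Fintype.card P ^ 2 / 4 + 1 + 1), n.choose i := by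
      refine Finset.sum_le_sum_of_subset fun i hi => ?_
      rw [Finset.mem_Iic] at hi
      rw [Finset.mem_range]
      omega
    _ ≤ 2 * n ^ (Fintype.card P ^ 2 / 4 + 1) := sum_range_succ_choose_le hn2 _
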